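/- arXiv:1711.11208 — 8 statements merged into one kernel-verified Lean document; each statement's English description precedes it below -/
import Mathlib

section
/- Let A = (Q, Σ, →) be a labeled transition system and p₀, q₀ ∈ Q be infinitary failure trace equivalent processes (i.e., FT(p₀) = FT(q₀) and FT^∞(p₀) = FT^∞(q₀)). Then for every subset F ⊆ Σ, the strong fair languages of p₀ and q₀ with respect to F are equal: L^Φ_F(p₀) = L^Φ_F(q₀). -/
/-- A labeled transition system over states `Q` and alphabet `σ`. -/
structure LTS (Q σ : Type) where
  tr : Q → σ → Q → Prop

namespace LTS

variable {Q σ : Type}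

/-- Action `a` is enabled in process `p`. -/
def Enabled (A : LTS Q σ) (p : Q) (a : σ) : Prop := ∃ p', A.tr p a p'

/-- `FinRun A p l q` : there is a finite run from `p` to `q` with trace `l`. -/
inductive FinRun (A : LTS Q σ) : Q → List σ → Q → Prop
  | nil (p : Q) : FinRun A p [] p
  | cons {p p' q : Q} {a : σ} {l : List σ} :
      A.tr p a p' → FinRun A p' l q → FinRun A p (a :: l) q

/-- Traces of finite runs of `p`. -/
def FinTraces (A : LTS Q σ) (p : Q) : Set (List σ) := {l | ∃ q, A.FinRun p l q}

/-- An infinite run of `p` with state sequence `s` and label sequence `w`. -/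
def InfRun (A : LTS Q σ) (p : Q) (s : ℕ → Q) (w : ℕ → σ) : Prop :=
  s 0 = p ∧ ∀ i, A.tr (s i) (w i) (s (i + 1))

/-- Traces of infinite runs of `p`. -/
def InfTraces (A : LTS Q σ) (p : Q) : Set (ℕ → σ) := {w | ∃ s, A.InfRun p s w}

/-- An infinite run (given by states `s` and labels `w`) is strong fair w.r.t. `F`:
for every `a ∈ F`, if `a` is enabled in infinitely many states then `a` occurs
infinitely often among the labels. -/
def StrongFair (A : LTS Q σ) (F : Set σ) (s : ℕ → Q) (w : ℕ → σ) : Prop :=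
  ∀ a ∈ F, (∀ i, ∃ j, i ≤ j ∧ A.Enabled (s j) a) → (∀ i, ∃ j, i ≤ j ∧ w j = a)

/-- An infinite run is weak fair w.r.t. `F`: for every `a ∈ F`, if from some point
on `a` is always enabled, then `a` occurs infinitely often among the labels. -/
def WeakFair (A : LTS Q σ) (F : Set σ) (s : ℕ → Q) (w : ℕ → σ) : Prop :=
  ∀ a ∈ F, (∃ i, ∀ j, i ≤ j → A.Enabled (s j) a) → (∀ i, ∃ j, i ≤ j ∧ w j = a)

/-- The strong fair language of `p` w.r.t. `F`: all traces of finite runs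
(finite runs are always fair) together with all traces of strong fair infinite runs. -/
def SFairLang (A : LTS Q σ) (F : Set σ) (p : Q) : Set (List σ ⊕ (ℕ → σ)) :=
  fun x => Sum.elim (fun l => l ∈ A.FinTraces p)
    (fun w => ∃ s, A.InfRun p s w ∧ A.StrongFair F s w) x

/-- The weak fair language of `p` w.r.t. `F`: all traces of finite runs
(finite runs are always fair) together with all traces of weak fair infinite runs. -/
def WFairLang (A : LTS Q σ) (F : Set σ) (p : Q) : Set (List σ ⊕ (ℕ → σ)) :=
  fun x => Sum.elim (fun l => l ∈ A.FinTraces p)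
    (fun w => ∃ s, A.InfRun p s w ∧ A.WeakFair F s w) x

end LTS

namespace LTS

variable {Q σ : Type}

/-- `FTraceFrom A p l` : `l` is a finite failure trace of `p`, a word over `σ ⊕ Set σ`
where letters are transitions taken and sets are refusal sets (subsets of the
disabled actions) of the current process. -/
inductive FTraceFrom (A : LTS Q σ) : Q → List (σ ⊕ Set σ) → Prop
  | nil (p : Q) : FTraceFrom A p []
  | act {p p' : Q} {a : σ} {l : List (σ ⊕ Set σ)} :
      A.tr p a p' → FTraceFrom A p' l → FTraceFrom A p (Sum.inl a :: l)
  | ref {p : Q} {X : Set σ} {l : List (σ ⊕ Set σ)} :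
      (∀ a ∈ X, ¬ A.Enabled p a) → FTraceFrom A p l → FTraceFrom A p (Sum.inr X :: l)

/-- The set of finite failure traces of `p`. -/
def FTraces (A : LTS Q σ) (p : Q) : Set (List (σ ⊕ Set σ)) := {l | A.FTraceFrom p l}

/-- The set of infinite failure traces of `p`. -/
def InfFTraces (A : LTS Q σ) (p : Q) : Set (ℕ → σ ⊕ Set σ) :=
  {w | ∃ s : ℕ → Q, s 0 = p ∧ ∀ i,
    (∃ a : σ, w i = Sum.inl a ∧ A.tr (s i) a (s (i + 1))) ∨
    (∃ X : Set σ, w i = Sum.inr X ∧ s (i + 1) = s i ∧ ∀ a ∈ X, ¬ A.Enabled (s i) a)}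

end LTS

namespace LTS

theorem fTraceFrom_map_inl_iff {Q σ : Type} (A : LTS Q σ) (l : List σ) (p : Q) :
    A.FTraceFrom p (l.map Sum.inl) ↔ l ∈ A.FinTraces p := by
  induction l generalizing p with
  | nil => exact ⟨fun _ => ⟨p, .nil p⟩, fun _ => .nil p⟩
  | cons a l ih =>
    constructor
    · intro h
      rw [List.map_cons] at h
      cases h with
      | act ht hl =>
        obtain ⟨q, hq⟩ := (ih _).1 hl
        exact ⟨q, .cons ht hq⟩
    · rintro ⟨q, hq⟩
      cases hq with
      | cons ht hl => exact .act ht ((ih _).2 ⟨q, hl⟩)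

/-- The infinite failure trace which, at every step of a run, first refuses `X i` and then
performs `w i`. -/
def interleave {σ : Type} (X : ℕ → Set σ) (w : ℕ → σ) (n : ℕ) : σ ⊕ Set σ :=
  if n % 2 = 0 then Sum.inr (X (n / 2)) else Sum.inl (w (n / 2))

theorem interleave_even {σ : Type} (X : ℕ → Set σ) (w : ℕ → σ) (i : ℕ) :
    interleave X w (2 * i) = Sum.inr (X i) := by
  simp [interleave]

theorem interleave_odd {σ : Type} (X : ℕ → Set σ) (w : ℕ → σ) (i : ℕ) :
    interleave X w (2 * i + 1) = Sum.inl (w i) := by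
  have h : (2 * i + 1) / 2 = i := by omega
  simp [interleave, h]

theorem interleave_mem_infFTraces_iff {Q σ : Type} (A : LTS Q σ) (p : Q) (X : ℕ → Set σ)
    (w : ℕ → σ) :
    interleave X w ∈ A.InfFTraces p ↔
      ∃ s, A.InfRun p s w ∧ ∀ i, ∀ a ∈ X i, ¬ A.Enabled (s i) a := by
  constructor
  · rintro ⟨t, h0, ht⟩
    have even (i : ℕ) : t (2 * i + 1) = t (2 * i) ∧ ∀ a ∈ X i, ¬ A.Enabled (t (2 * i)) a := by
      simpa [interleave_even] using ht (2 * i)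
    have odd (i : ℕ) : A.tr (t (2 * i + 1)) (w i) (t (2 * i + 1 + 1)) := by
      simpa [interleave_odd] using ht (2 * i + 1)
    refine ⟨fun i => t (2 * i), ⟨h0, fun i => ?_⟩, fun i => (even i).2⟩
    have h := odd i
    rwa [(even i).1] at h
  · rintro ⟨s, ⟨h0, hs⟩, hX⟩
    refine ⟨fun n => s (n / 2), by simpa using h0, fun n => ?_⟩
    obtain ⟨i, rfl | rfl⟩ := n.even_or_odd'
    · have h1 : (2 * i + 1) / 2 = i := by omega
      have h2 : 2 * i / 2 = i := by omega
      exact .inr ⟨X i, interleave_even X w i, by simp only [h1, h2], by simpa only [h2] using hX i⟩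
    · have h1 : (2 * i + 1) / 2 = i := by omega
      have h2 : (2 * i + 1 + 1) / 2 = i + 1 := by omega
      exact .inl ⟨w i, interleave_odd X w i, by simpa only [h1, h2] using hs i⟩

/-- Enabling fewer actions along a run preserves strong fairness. -/
theorem StrongFair.mono {Q σ : Type} {A : LTS Q σ} {F : Set σ} {s t : ℕ → Q} {w : ℕ → σ}
    (hs : A.StrongFair F s w) (h : ∀ i a, A.Enabled (t i) a → A.Enabled (s i) a) :
    A.StrongFair F t w := fun a ha ht =>
  hs a ha fun i => (ht i).imp fun j hj => ⟨hj.1, h j a hj.2⟩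

theorem sFairLang_subset {Q σ : Type} (A : LTS Q σ) (F : Set σ) {p q : Q}
    (hfin : A.FTraces p ⊆ A.FTraces q) (hinf : A.InfFTraces p ⊆ A.InfFTraces q) :
    A.SFairLang F p ⊆ A.SFairLang F q := by
  rintro (l | w) hx
  · exact (fTraceFrom_map_inl_iff A l q).1 (hfin ((fTraceFrom_map_inl_iff A l p).2 hx))
  · obtain ⟨s, hs, hfair⟩ := hx
    obtain ⟨t, ht, hX⟩ := (interleave_mem_infFTraces_iff A q _ w).1
      (hinf ((interleave_mem_infFTraces_iff A p (fun i => {a | ¬ A.Enabled (s i) a}) w).2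
        ⟨s, hs, fun _ _ ha => ha⟩))
    exact ⟨t, ht, hfair.mono fun i a ha => by_contra fun hn => hX i a hn ha⟩

end LTS

/-- If `p₀` and `q₀` are infinitary failure trace equivalent
(equal finite and infinite failure traces), then for every `F ⊆ Σ` their strong
fair languages w.r.t. `F` coincide. -/
theorem strongFairLang_eq_of_failureTraceEquiv {Q σ : Type} (A : LTS Q σ) (p₀ q₀ : Q)
    (hfin : A.FTraces p₀ = A.FTraces q₀)
    (hinf : A.InfFTraces p₀ = A.InfFTraces q₀) :
    ∀ F : Set σ, A.SFairLang F p₀ = A.SFairLang F q₀ := by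
  exact fun F => (A.sFairLang_subset F hfin.subset hinf.subset).antisymm
    (A.sFairLang_subset F hfin.symm.subset hinf.symm.subset)
end

section
/- Let A = (Q, Σ, →) be a labeled transition system and p₀, q₀ ∈ Q be infinitary failure trace equivalent processes (i.e., FT(p₀) = FT(q₀) and FT^∞(p₀) = FT^∞(q₀)). Then for every subset F ⊆ Σ, the weak fair languages of p₀ and q₀ with respect to F are equal: L^φ_F(p₀) = L^φ_F(q₀). -/
namespace LTS

variable {Q σ : Type}

theorem mem_finTraces_iff_map_inl_mem_fTraces (A : LTS Q σ) (p : Q) (l : List σ) :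
    l ∈ A.FinTraces p ↔ l.map Sum.inl ∈ A.FTraces p := by
  constructor
  · rintro ⟨q, h⟩
    induction h with
    | nil p => exact FTraceFrom.nil p
    | cons h _ ih => exact FTraceFrom.act h ih
  · intro h
    induction l generalizing p with
    | nil => exact ⟨p, FinRun.nil p⟩
    | cons a l ih =>
      cases h with
      | act h h' =>
        obtain ⟨q, hq⟩ := ih _ h'
        exact ⟨q, FinRun.cons h hq⟩

/-- If the infinite failure traces of `p` are among those of `q`, then every infinite run of `p` is
matched by a run of `q` with the same trace that enables no further actions along the way. -/
theorem exists_infRun_enabled_imp {A : LTS Q σ} {p q : Q}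
    (hpq : A.InfFTraces p ⊆ A.InfFTraces q) {s : ℕ → Q} {w : ℕ → σ} (hs : A.InfRun p s w) :
    ∃ t, A.InfRun q t w ∧ ∀ i a, A.Enabled (t i) a → A.Enabled (s i) a := by
  let u : ℕ → σ ⊕ Set σ := fun n =>
    if n % 2 = 0 then Sum.inr {a | ¬ A.Enabled (s (n / 2)) a} else Sum.inl (w (n / 2))
  have hu₀ (i : ℕ) : u (2 * i) = Sum.inr {a | ¬ A.Enabled (s i) a} := by simp [u]
  have hu₁ (i : ℕ) : u (2 * i + 1) = Sum.inl (w i) := by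
    have : (2 * i + 1) / 2 = i := by omega
    simp [u, this]
  have hu : u ∈ A.InfFTraces p := by
    refine ⟨fun n => s (n / 2), by simpa using hs.1, fun n => ?_⟩
    obtain ⟨i, rfl | rfl⟩ := n.even_or_odd'
    · have h₀ : 2 * i / 2 = i := by omega
      have h₁ : (2 * i + 1) / 2 = i := by omega
      exact Or.inr ⟨_, hu₀ i, by simp only [h₀, h₁], by simp only [h₀]; exact fun a ha => ha⟩
    · have h₁ : (2 * i + 1) / 2 = i := by omega
      have h₂ : (2 * i + 1 + 1) / 2 = i + 1 := by omega
      exact Or.inl ⟨_, hu₁ i, by simpa only [h₁, h₂] using hs.2 i⟩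
  obtain ⟨t, ht, htu⟩ := hpq hu
  have href (i : ℕ) : t (2 * i + 1) = t (2 * i) ∧
      ∀ a, ¬ A.Enabled (s i) a → ¬ A.Enabled (t (2 * i)) a := by
    rcases htu (2 * i) with ⟨a, ha, -⟩ | ⟨X, hX, h, h'⟩
    · simp [hu₀] at ha
    · rw [hu₀] at hX
      cases hX
      exact ⟨h, h'⟩
  refine ⟨fun i => t (2 * i), ⟨ht, fun i => ?_⟩, fun i a => not_imp_not.1 ((href i).2 a)⟩
  rcases htu (2 * i + 1) with ⟨a, ha, h⟩ | ⟨X, hX, -⟩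
  · rw [hu₁] at ha
    cases ha
    rwa [(href i).1] at h
  · simp [hu₁] at hX

theorem wFairLang_subset {A : LTS Q σ} {p q : Q} (hfin : A.FTraces p ⊆ A.FTraces q)
    (hinf : A.InfFTraces p ⊆ A.InfFTraces q) (F : Set σ) :
    A.WFairLang F p ⊆ A.WFairLang F q := by
  rintro (l | w) h
  · exact (A.mem_finTraces_iff_map_inl_mem_fTraces q l).2
      (hfin ((A.mem_finTraces_iff_map_inl_mem_fTraces p l).1 h))
  · obtain ⟨s, hs, hfair⟩ := h
    obtain ⟨t, ht, hts⟩ := exists_infRun_enabled_imp hinf hs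
    exact ⟨t, ht, fun a ha ⟨i, hi⟩ => hfair a ha ⟨i, fun j hj => hts j a (hi j hj)⟩⟩

end LTS

/-- If `p₀` and `q₀` are infinitary failure trace equivalent
(equal finite and infinite failure traces), then for every `F ⊆ Σ` their weak
fair languages w.r.t. `F` coincide. -/
theorem weakFairLang_eq_of_failureTraceEquiv {Q σ : Type} (A : LTS Q σ) (p₀ q₀ : Q)
    (hfin : A.FTraces p₀ = A.FTraces q₀)
    (hinf : A.InfFTraces p₀ = A.InfFTraces q₀) :
    ∀ F : Set σ, A.WFairLang F p₀ = A.WFairLang F q₀ := by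
  exact fun F => (LTS.wFairLang_subset hfin.subset hinf.subset F).antisymm
    (LTS.wFairLang_subset hfin.superset hinf.superset F)
end

section
/- There exists a finite labeled transition system A = (Q, Σ, →) with two processes p, q ∈ Q that are infinitary trace equivalent (Traces(p) = Traces(q) and Traces^∞(p) = Traces^∞(q)) but whose strong fair languages differ for some F ⊆ Σ; concretely, over Σ = {a, b} take Q = {p, q, q'} with transitions p →a p, p →b p, q →a q, q →b q, q →b q', q' →b q'. Then p and q are infinitary trace equivalent, yet for F = {a}, the infinite trace b^ω belongs to L^Φ_{{a}}(q) but not to L^Φ_{{a}}(p), so L^Φ_{{a}}(p) ≠ L^Φ_{{a}}(q). -/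
/-- States `p`, `q`, `q'` of the counterexample LTS. -/
inductive St3 : Type
  | p | q | q'

/-- The two-letter alphabet `{a, b}`. -/
inductive Act2 : Type
  | a | b

/-- The counterexample LTS: `p →a p`, `p →b p`, `q →a q`, `q →b q`,
`q →b q'`, `q' →b q'`. -/
inductive Tr3 : St3 → Act2 → St3 → Prop
  | pa : Tr3 .p .a .p
  | pb : Tr3 .p .b .p
  | qa : Tr3 .q .a .q
  | qb : Tr3 .q .b .q
  | qq' : Tr3 .q .b .q'
  | q'b : Tr3 .q' .b .q'

/-- The counterexample LTS. -/
def A3 : LTS St3 Act2 := ⟨Tr3⟩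

namespace LTS

variable {Q σ : Type} {A : LTS Q σ} {r : Q}

theorem finTraces_eq_univ_of_self_loops (h : ∀ x, A.tr r x r) :
    A.FinTraces r = Set.univ :=
  Set.eq_univ_of_forall fun l => ⟨r, by
    induction l with
    | nil => exact .nil r
    | cons x l ih => exact .cons (h x) ih⟩

theorem infTraces_eq_univ_of_self_loops (h : ∀ x, A.tr r x r) :
    A.InfTraces r = Set.univ :=
  Set.eq_univ_of_forall fun w => ⟨fun _ => r, rfl, fun i => h (w i)⟩

end LTS

theorem A3_self_loops_p (x : Act2) : A3.tr .p x .p := by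
  cases x
  exacts [.pa, .pb]

theorem A3_self_loops_q (x : Act2) : A3.tr .q x .q := by
  cases x
  exacts [.qa, .qb]

theorem A3_eq_p_of_infRun_p {s : ℕ → St3} {w : ℕ → Act2} (h : A3.InfRun .p s w) (i : ℕ) :
    s i = .p := by
  induction i with
  | zero => exact h.1
  | succ i ih =>
    have ht : Tr3 (s i) (w i) (s (i + 1)) := h.2 i
    rw [ih] at ht
    generalize w i = x, s (i + 1) = t at ht ⊢
    cases ht <;> rfl

theorem A3_not_enabled_q'_a : ¬ A3.Enabled .q' .a := by
  rintro ⟨t, ht⟩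
  cases ht

theorem b_omega_mem_sFairLang_q :
    Sum.inr (fun _ => Act2.b) ∈ A3.SFairLang {Act2.a} St3.q := by
  refine ⟨fun | 0 => .q | _ + 1 => .q', ⟨rfl, fun | 0 => .qq' | _ + 1 => .q'b⟩, ?_⟩
  rintro x rfl h
  obtain ⟨j, hj, he⟩ := h 1
  obtain ⟨k, rfl⟩ := Nat.exists_eq_add_of_le' hj
  exact absurd he A3_not_enabled_q'_a

theorem b_omega_notMem_sFairLang_p :
    Sum.inr (fun _ => Act2.b) ∉ A3.SFairLang {Act2.a} St3.p := by
  rintro ⟨s, hs, hf⟩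
  obtain ⟨j, -, hj⟩ := hf .a rfl
    (fun i => ⟨i, le_rfl, .p, A3_eq_p_of_infRun_p hs i ▸ A3_self_loops_p .a⟩) 0
  cases hj

/-- The processes `p` and `q` of the LTS `A3` are infinitary trace
equivalent, yet `b^ω` is in the strong fair language of `q` w.r.t. `F = {a}` but not
in that of `p`; in particular the strong fair languages differ. -/
theorem trace_equiv_not_preserve_strong_fairness :
    A3.FinTraces St3.p = A3.FinTraces St3.q ∧
    A3.InfTraces St3.p = A3.InfTraces St3.q ∧
    Sum.inr (fun _ => Act2.b) ∈ A3.SFairLang {Act2.a} St3.q ∧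
    Sum.inr (fun _ => Act2.b) ∉ A3.SFairLang {Act2.a} St3.p ∧
    A3.SFairLang {Act2.a} St3.p ≠ A3.SFairLang {Act2.a} St3.q := by
  refine ⟨?_, ?_, b_omega_mem_sFairLang_q, b_omega_notMem_sFairLang_p, fun h =>
    b_omega_notMem_sFairLang_p (h ▸ b_omega_mem_sFairLang_q)⟩
  · rw [LTS.finTraces_eq_univ_of_self_loops A3_self_loops_p,
      LTS.finTraces_eq_univ_of_self_loops A3_self_loops_q]
  · rw [LTS.infTraces_eq_univ_of_self_loops A3_self_loops_p,
      LTS.infTraces_eq_univ_of_self_loops A3_self_loops_q]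
end

section
/- There exists a finite labeled transition system A = (Q, Σ, →) with two processes p, q ∈ Q that are simulation equivalent but whose strong fair languages differ for some F ⊆ Σ; concretely, over Σ = {a, b} take Q = {p, q, q'} with transitions p →a p, p →b p, q →a q, q →b q, q →b q', q' →b q'. Then p and q are simulation equivalent, yet for F = {a}, the infinite trace b^ω belongs to L^Φ_{{a}}(q) but not to L^Φ_{{a}}(p), so L^Φ_{{a}}(p) ≠ L^Φ_{{a}}(q). -/
namespace LTS

variable {Q σ : Type}

/-- `R` is a simulation on the LTS `A`. -/
def IsSimulation (A : LTS Q σ) (R : Q → Q → Prop) : Prop :=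
  ∀ p q, R p q → ∀ (a : σ) (p' : Q), A.tr p a p' → ∃ q', A.tr q a q' ∧ R p' q'

/-- `p` and `q` are simulation equivalent: there is a simulation relating `p` to `q`
and a simulation relating `q` to `p`. -/
def SimEquiv (A : LTS Q σ) (p q : Q) : Prop :=
  (∃ R, A.IsSimulation R ∧ R p q) ∧ (∃ R, A.IsSimulation R ∧ R q p)

end LTS

/-- The processes `p` and `q` of the LTS `A3` are simulation
equivalent, yet `b^ω` is in the strong fair language of `q` w.r.t. `F = {a}` but not
in that of `p`; in particular the strong fair languages differ. -/
theorem sim_equiv_not_preserve_strong_fairness :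
    A3.SimEquiv St3.p St3.q ∧
    Sum.inr (fun _ => Act2.b) ∈ A3.SFairLang {Act2.a} St3.q ∧
    Sum.inr (fun _ => Act2.b) ∉ A3.SFairLang {Act2.a} St3.p ∧
    A3.SFairLang {Act2.a} St3.p ≠ A3.SFairLang {Act2.a} St3.q := by
  have hq : Sum.inr (fun _ => Act2.b) ∈ A3.SFairLang {Act2.a} St3.q := by
    refine ⟨fun i => Nat.casesOn i St3.q fun _ => St3.q', ⟨rfl, ?_⟩, ?_⟩
    · rintro (_ | i)
      · exact Tr3.qq'
      · exact Tr3.q'b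
    · rintro _ rfl hen
      obtain ⟨_ | j, hj, _, htr⟩ := hen 1
      · omega
      · cases htr
  have hp : Sum.inr (fun _ => Act2.b) ∉ A3.SFairLang {Act2.a} St3.p := by
    rintro ⟨s, ⟨h0, hs⟩, hfair⟩
    have hsp : ∀ i, s i = St3.p := by
      intro i
      induction i with
      | zero => exact h0
      | succ i ih =>
        have htr : Tr3 (s i) Act2.b (s (i + 1)) := hs i
        rw [ih] at htr
        generalize s (i + 1) = x at htr ⊢
        cases htr
        rfl
    obtain ⟨_, _, h⟩ := hfair Act2.a rfl
      (fun i => ⟨i, le_rfl, St3.p, by rw [hsp i]; exact Tr3.pa⟩) 0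
    cases h
  refine ⟨⟨⟨fun x y => x = St3.p ∧ y = St3.q, ?_, rfl, rfl⟩,
    ⟨fun _ y => y = St3.p, ?_, rfl⟩⟩, hq, hp, fun h => hp (h ▸ hq)⟩
  · rintro _ _ ⟨rfl, rfl⟩ _ _ (_ | _)
    · exact ⟨St3.q, Tr3.qa, rfl, rfl⟩
    · exact ⟨St3.q, Tr3.qb, rfl, rfl⟩
  · rintro _ _ rfl (_ | _) _ _
    · exact ⟨St3.p, Tr3.pa, rfl⟩
    · exact ⟨St3.p, Tr3.pb, rfl⟩
end

section
/- There exists a finite labeled transition system A = (Q, Σ, →) with two processes p, q ∈ Q that are simulation equivalent but whose weak fair languages differ for some F ⊆ Σ; concretely, over Σ = {a, b} take Q = {p, q, q'} with transitions p →a p, p →b p, q →a q, q →b q, q →b q', q' →b q'. Then p and q are simulation equivalent, yet for F = {a}, the infinite trace b^ω belongs to L^φ_{{a}}(q) but not to L^φ_{{a}}(p), so L^φ_{{a}}(p) ≠ L^φ_{{a}}(q). -/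
theorem simEquiv_p_q : A3.SimEquiv St3.p St3.q := by
  refine ⟨⟨fun x y => x = .p ∧ y = .q, ?_, rfl, rfl⟩, ⟨fun _ y => y = .p, ?_, rfl⟩⟩
  · rintro _ _ ⟨rfl, rfl⟩ _ _ h
    cases h
    · exact ⟨.q, .qa, rfl, rfl⟩
    · exact ⟨.q, .qb, rfl, rfl⟩
  · rintro _ _ rfl c _ _
    cases c
    · exact ⟨.p, .pa, rfl⟩
    · exact ⟨.p, .pb, rfl⟩

/-- The run that moves to `q'` at once is weak fair, since `a` is not enabled in `q'`. -/
theorem b_omega_mem_wFairLang_q :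
    Sum.inr (fun _ => Act2.b) ∈ A3.WFairLang {Act2.a} St3.q := by
  refine ⟨fun | 0 => .q | _ + 1 => .q', ⟨rfl, ?_⟩, ?_⟩
  · rintro (_ | i)
    · exact .qq'
    · exact .q'b
  · rintro _ rfl ⟨i, hi⟩
    obtain ⟨_, h⟩ := hi (i + 1) i.le_succ
    cases h

/-- A run from `p` stays in `p`, where `a` is always enabled. -/
theorem b_omega_notMem_wFairLang_p :
    Sum.inr (fun _ => Act2.b) ∉ A3.WFairLang {Act2.a} St3.p := by
  rintro ⟨s, ⟨h0, hs⟩, hfair⟩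
  have stay : ∀ i, s i = .p := by
    intro i
    induction i with
    | zero => exact h0
    | succ i ih =>
      have h : Tr3 (s i) .b (s (i + 1)) := hs i
      rw [ih] at h
      generalize s (i + 1) = y at h
      cases h
      rfl
  obtain ⟨_, _, h⟩ := hfair .a rfl ⟨0, fun j _ => ⟨.p, by rw [stay j]; exact .pa⟩⟩ 0
  cases h

/-- The processes `p` and `q` of the LTS `A3` are simulation
equivalent, yet `b^ω` is in the weak fair language of `q` w.r.t. `F = {a}` but not
in that of `p`; in particular the weak fair languages differ. -/
theorem sim_equiv_not_preserve_weak_fairness :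
    A3.SimEquiv St3.p St3.q ∧
    Sum.inr (fun _ => Act2.b) ∈ A3.WFairLang {Act2.a} St3.q ∧
    Sum.inr (fun _ => Act2.b) ∉ A3.WFairLang {Act2.a} St3.p ∧
    A3.WFairLang {Act2.a} St3.p ≠ A3.WFairLang {Act2.a} St3.q := by
  refine ⟨simEquiv_p_q, b_omega_mem_wFairLang_q, b_omega_notMem_wFairLang_p, fun h => ?_⟩
  exact b_omega_notMem_wFairLang_p (h ▸ b_omega_mem_wFairLang_q)
end

section
/- There exists a finite labeled transition system A = (Q, Σ, →) with two processes r, s ∈ Q that are infinitary ready equivalent but whose strong fair languages differ for some F ⊆ Σ; concretely, over Σ = {a, b, c, d} take the two processes r and s, each the root of two abc-cycles of length three back to the root, where in r the d-transitions are attached to the two intermediate states of the right cycle only (after a and after ab on the right branch), while in s one d-transition is attached to an intermediate state of the right cycle (after a on the right branch) and the other to an intermediate state of the left cycle (after ab on the left branch). Then r and s are infinitary ready equivalent, yet for F = {d}, the infinite trace (abc)^ω belongs to L^Φ_{{d}}(r) but not to L^Φ_{{d}}(s), so L^Φ_{{d}}(r) ≠ L^Φ_{{d}}(s). -/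
namespace LTS

variable {Q σ : Type}

/-- The ready pairs of `p`: a trace `x.1` of a finite run from `p` to some `q`
together with the set `x.2` of exactly the actions enabled in `q`. -/
def ReadyPairs (A : LTS Q σ) (p : Q) : Set (List σ × Set σ) :=
  {x | ∃ q, A.FinRun p x.1 q ∧ x.2 = {a | A.Enabled q a}}

end LTS

/-- The four-letter alphabet `{a, b, c, d}`. -/
inductive Act4 : Type
  | a | b | c | d

/-- States of the counterexample LTS for ready equivalence:
`r` with a left `abc`-cycle `r → rl1 → rl2 → r` and a right `abc`-cycle
`r → rr1 → rr2 → r`, with `d`-transitions from `rr1` and `rr2`;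
`s` with a left `abc`-cycle `s → sl1 → sl2 → s` and a right `abc`-cycle
`s → sr1 → sr2 → s`, with `d`-transitions from `sr1` and `sl2`. -/
inductive St9 : Type
  | r | rl1 | rl2 | rr1 | rr2 | rd1 | rd2
  | s | sl1 | sl2 | sr1 | sr2 | sd1 | sd2

/-- Transitions of the counterexample. -/
inductive Tr9 : St9 → Act4 → St9 → Prop
  | rla : Tr9 .r .a .rl1
  | rlb : Tr9 .rl1 .b .rl2
  | rlc : Tr9 .rl2 .c .r
  | rra : Tr9 .r .a .rr1
  | rrb : Tr9 .rr1 .b .rr2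
  | rrc : Tr9 .rr2 .c .r
  | rd1 : Tr9 .rr1 .d .rd1
  | rd2 : Tr9 .rr2 .d .rd2
  | sla : Tr9 .s .a .sl1
  | slb : Tr9 .sl1 .b .sl2
  | slc : Tr9 .sl2 .c .s
  | sra : Tr9 .s .a .sr1
  | srb : Tr9 .sr1 .b .sr2
  | src : Tr9 .sr2 .c .s
  | sd1 : Tr9 .sr1 .d .sd1
  | sd2 : Tr9 .sl2 .d .sd2

/-- The counterexample LTS. -/
def A9 : LTS St9 Act4 := ⟨Tr9⟩

/-- The infinite trace `(abc)^ω`. -/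
def abcω : ℕ → Act4 := fun i =>
  match i % 3 with
  | 0 => Act4.a
  | 1 => Act4.b
  | _ => Act4.c

/-- If every related state can be matched backwards along transitions, then so can it along
finite runs. -/
theorem LTS.FinRun.exists_of_backward_simulation {Q σ : Type} {A : LTS Q σ} {R : Q → Q → Prop}
    (hR : ∀ p a q q', A.tr p a q → R q q' → ∃ p', A.tr p' a q' ∧ R p p')
    {p q q' : Q} {l : List σ} (h : A.FinRun p l q) (hq : R q q') :
    ∃ p', R p p' ∧ A.FinRun p' l q' := by
  induction h with
  | nil p => exact ⟨q', hq, .nil q'⟩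
  | cons hstep _ ih =>
    obtain ⟨p₁', hp₁, hrun⟩ := ih hq
    obtain ⟨p', hstep', hp⟩ := hR _ _ _ _ hstep hp₁
    exact ⟨p', hp, .cons hstep' hrun⟩

theorem LTS.finTraces_eq_image_readyPairs {Q σ : Type} (A : LTS Q σ) (p : Q) :
    A.FinTraces p = Prod.fst '' A.ReadyPairs p := by
  ext l
  constructor
  · rintro ⟨q, hq⟩
    exact ⟨(l, {a | A.Enabled q a}), ⟨q, hq, rfl⟩, rfl⟩
  · rintro ⟨_, ⟨q, hq, _⟩, rfl⟩
    exact ⟨q, hq⟩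

namespace St9

/-- Whether a state belongs to the component of `r`. -/
def inR : St9 → Bool
  | r | rl1 | rl2 | rr1 | rr2 | rd1 | rd2 => true
  | _ => false

/-- The position of a state within its component, ignoring the branch taken. -/
def level : St9 → ℕ
  | r | s => 0
  | rl1 | rr1 | sl1 | sr1 => 1
  | rl2 | rr2 | sl2 | sr2 => 2
  | rd1 | sd1 => 3
  | rd2 | sd2 => 4

/-- States at the same position of different components. -/
def Opposite (p q : St9) : Prop := p.level = q.level ∧ p.inR ≠ q.inR

/-- The exchange of the two components that respects left and right branches. -/
def swap : St9 → St9
  | r => s | rl1 => sl1 | rl2 => sl2 | rr1 => sr1 | rr2 => sr2 | rd1 => sd1 | rd2 => sd2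
  | s => r | sl1 => rl1 | sl2 => rl2 | sr1 => rr1 | sr2 => rr2 | sd1 => rd1 | sd2 => rd2

/-- A state of the other component with the same enabled actions. -/
def mate : St9 → St9
  | rl2 => sr2 | rr2 => sl2 | sl2 => rr2 | sr2 => rl2
  | p => p.swap

theorem opposite_mate (p : St9) : Opposite p p.mate := by
  cases p <;> simp [Opposite, level, inR, mate, swap]

theorem enabled_mate (p : St9) (x : Act4) : A9.Enabled p.mate x ↔ A9.Enabled p x := by
  have enabled_of : ∀ p : St9, A9.Enabled p x → A9.Enabled p.mate x := by
    rintro p ⟨_, h⟩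
    cases h <;> exact ⟨_, by constructor⟩
  have mate_mate : p.mate.mate = p := by cases p <;> rfl
  exact ⟨fun h => mate_mate ▸ enabled_of _ h, enabled_of p⟩

theorem eq_swap_of_opposite_root {p q : St9} (hp : p.level = 0) (h : Opposite p q) :
    q = p.swap := by
  cases p <;> cases q <;> simp_all [Opposite, level, inR, swap]

theorem opposite_backward (p : St9) (x : Act4) (q q' : St9) (h : A9.tr p x q)
    (hq : Opposite q q') : ∃ p', A9.tr p' x q' ∧ Opposite p p' := by
  cases h <;> cases q' <;> simp [Opposite, level, inR] at hq <;>
    exact ⟨_, by constructor, by decide, by decide⟩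

theorem readyPairs_subset_swap {p : St9} (hp : p.level = 0) :
    A9.ReadyPairs p ⊆ A9.ReadyPairs p.swap := by
  rintro ⟨l, X⟩ ⟨q, hrun, hX⟩
  obtain ⟨p', hp', hrun'⟩ :=
    hrun.exists_of_backward_simulation opposite_backward (opposite_mate q)
  rw [eq_swap_of_opposite_root hp hp'] at hrun'
  exact ⟨q.mate, hrun', by simpa only [enabled_mate] using hX⟩

/-- Transitions that do not lead into a deadlock are preserved by `swap`. -/
theorem tr_swap {p q q' : St9} {x y : Act4} (h : Tr9 p x q) (h' : Tr9 q y q') :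
    Tr9 p.swap x q.swap := by
  cases h <;> first | constructor | cases h'

theorem infTraces_subset_swap (p : St9) : A9.InfTraces p ⊆ A9.InfTraces p.swap := by
  rintro w ⟨t, h0, ht⟩
  exact ⟨fun i => (t i).swap, congrArg swap h0, fun i => tr_swap (ht i) (ht (i + 1))⟩

end St9

theorem abcω_three_mul (k : ℕ) : abcω (3 * k) = .a := by
  simp [abcω]

theorem abcω_three_mul_add_one (k : ℕ) : abcω (3 * k + 1) = .b := by
  simp [abcω]

theorem abcω_three_mul_add_two (k : ℕ) : abcω (3 * k + 2) = .c := by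
  simp [abcω]

theorem abcω_ne_d (i : ℕ) : abcω i ≠ .d := by
  unfold abcω
  split <;> simp

/-- A full `abc`-cycle from `s` returns to `s` and passes a state enabling `d`. -/
theorem Tr9.abc_cycle_s {x y z : St9} (ha : Tr9 .s .a x) (hb : Tr9 x .b y) (hc : Tr9 y .c z) :
    z = .s ∧ (A9.Enabled x .d ∨ A9.Enabled y .d) := by
  cases ha <;> cases hb <;> cases hc
  · exact ⟨rfl, .inr ⟨_, .sd2⟩⟩
  · exact ⟨rfl, .inl ⟨_, .sd1⟩⟩

theorem abcω_mem_sFairLang_r : Sum.inr abcω ∈ A9.SFairLang {Act4.d} St9.r := by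
  let t : ℕ → St9 := fun i =>
    match i % 3 with
    | 0 => .r
    | 1 => .rl1
    | _ => .rl2
  refine ⟨t, ⟨rfl, fun i => ?_⟩, ?_⟩
  · have hi : i % 3 = 0 ∧ (i + 1) % 3 = 1 ∨ i % 3 = 1 ∧ (i + 1) % 3 = 2 ∨
        i % 3 = 2 ∧ (i + 1) % 3 = 0 := by omega
    rcases hi with ⟨h, h'⟩ | ⟨h, h'⟩ | ⟨h, h'⟩ <;> simp only [t, abcω, h, h'] <;> constructor
  · rintro _ rfl hen
    obtain ⟨j, -, q, hq⟩ := hen 0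
    have hj : t j = .r ∨ t j = .rl1 ∨ t j = .rl2 := by
      simp only [t]
      split <;> simp
    rcases hj with h | h | h <;> rw [h] at hq <;> cases hq

theorem abcω_notMem_sFairLang_s : Sum.inr abcω ∉ A9.SFairLang {Act4.d} St9.s := by
  rintro ⟨t, ⟨h0, ht⟩, hfair⟩
  have cycle (k : ℕ) (hk : t (3 * k) = .s) : t (3 * k + 3) = .s ∧
      (A9.Enabled (t (3 * k + 1)) .d ∨ A9.Enabled (t (3 * k + 2)) .d) := by
    have ha := ht (3 * k)
    have hb := ht (3 * k + 1)
    have hc := ht (3 * k + 2)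
    rw [abcω_three_mul, hk] at ha
    rw [abcω_three_mul_add_one] at hb
    rw [abcω_three_mul_add_two] at hc
    exact Tr9.abc_cycle_s ha hb hc
  have root (k : ℕ) : t (3 * k) = .s := by
    induction k with
    | zero => exact h0
    | succ k ih => exact (cycle k ih).1
  obtain ⟨j, -, hj⟩ := hfair .d rfl (fun i => by
    rcases (cycle i (root i)).2 with h | h
    · exact ⟨_, by omega, h⟩
    · exact ⟨_, by omega, h⟩) 0
  exact abcω_ne_d j hj

/-- The processes `r` and `s` of the LTS `A9` are infinitary ready
equivalent, yet `(abc)^ω` is in the strong fair language of `r` w.r.t. `F = {d}` but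
not in that of `s`; in particular the strong fair languages differ. -/
theorem ready_equiv_not_preserve_strong_fairness :
    A9.ReadyPairs St9.r = A9.ReadyPairs St9.s ∧
    A9.FinTraces St9.r = A9.FinTraces St9.s ∧
    A9.InfTraces St9.r = A9.InfTraces St9.s ∧
    Sum.inr abcω ∈ A9.SFairLang {Act4.d} St9.r ∧
    Sum.inr abcω ∉ A9.SFairLang {Act4.d} St9.s ∧
    A9.SFairLang {Act4.d} St9.r ≠ A9.SFairLang {Act4.d} St9.s := by
  have hready : A9.ReadyPairs St9.r = A9.ReadyPairs St9.s :=
    (St9.readyPairs_subset_swap (p := .r) rfl).antisymm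
      (St9.readyPairs_subset_swap (p := .s) rfl)
  refine ⟨hready, ?_, ?_, abcω_mem_sFairLang_r, abcω_notMem_sFairLang_s, fun h => ?_⟩
  · rw [LTS.finTraces_eq_image_readyPairs, LTS.finTraces_eq_image_readyPairs, hready]
  · exact (St9.infTraces_subset_swap .r).antisymm (St9.infTraces_subset_swap .s)
  · exact abcω_notMem_sFairLang_s (h ▸ abcω_mem_sFairLang_r)
end

section
/- There exists a finite labeled transition system A = (Q, Σ, →) with two processes p, q ∈ Q that are infinitary possible futures equivalent but whose strong fair languages differ for some F ⊆ Σ; concretely, over Σ = {a, c} take p with an a-cycle of length two on its left (p →a p₁, p₁ →a p) and on its right p →a p₂, p₂ →a p, p₂ →c p₃, and take q with an a-cycle of length four (q →a q₁ →a q₂ →a q₃ →a q) where q₃ →c q₄, together with on its right q →a q₅, q₅ →a q, q₅ →c q₆. Then p and q are infinitary possible futures equivalent, yet for F = {c}, the infinite trace a^ω belongs to L^Φ_{{c}}(p) but not to L^Φ_{{c}}(q), so L^Φ_{{c}}(p) ≠ L^Φ_{{c}}(q). -/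
namespace LTS

variable {Q σ : Type}

/-- The possible futures of `p`: a trace `x.1` of a finite run from `p` to some `q`
together with the set `x.2` of all finite traces of `q`. -/
def PossibleFutures (A : LTS Q σ) (p : Q) : Set (List σ × Set (List σ)) :=
  {x | ∃ q, A.FinRun p x.1 q ∧ x.2 = A.FinTraces q}

end LTS

/-- The two-letter alphabet `{a, c}`. -/
inductive ActAC : Type
  | a | c

/-- States of the counterexample LTS for possible futures equivalence. -/
inductive St10 : Type
  | p | p1 | p2 | p3
  | q | q1 | q2 | q3 | q4 | q5 | q6

/-- Transitions: `p` has a left `a`-cycle of length two (`p → p1 → p`) and a right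
`a`-cycle of length two (`p → p2 → p`) with `p2 →c p3`; `q` has an `a`-cycle of
length four (`q → q1 → q2 → q3 → q`) with `q3 →c q4`, and a right `a`-cycle of
length two (`q → q5 → q`) with `q5 →c q6`. -/
inductive Tr10 : St10 → ActAC → St10 → Prop
  | pl1 : Tr10 .p .a .p1
  | pl2 : Tr10 .p1 .a .p
  | pr1 : Tr10 .p .a .p2
  | pr2 : Tr10 .p2 .a .p
  | pc  : Tr10 .p2 .c .p3
  | ql1 : Tr10 .q .a .q1
  | ql2 : Tr10 .q1 .a .q2
  | ql3 : Tr10 .q2 .a .q3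
  | ql4 : Tr10 .q3 .a .q
  | qc1 : Tr10 .q3 .c .q4
  | qr1 : Tr10 .q .a .q5
  | qr2 : Tr10 .q5 .a .q
  | qc2 : Tr10 .q5 .c .q6

/-- The counterexample LTS. -/
def A10 : LTS St10 ActAC := ⟨Tr10⟩

namespace St10

/-- The quotient of the LTS identifying trace equivalent states, with representatives reachable
from `p`. -/
def rep : St10 → St10
  | p | q | q2 => p
  | p1 | q1 => p1
  | p2 | q3 | q5 => p2
  | p3 | q4 | q6 => p3

end St10

theorem Tr10.rep {s t : St10} {x : ActAC} (h : Tr10 s x t) : Tr10 s.rep x t.rep := by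
  cases h <;> constructor

namespace A10

open LTS

theorem finRun_rep {s t : St10} {l : List ActAC} (h : A10.FinRun s l t) :
    A10.FinRun s.rep l t.rep := by
  induction h with
  | nil s => exact .nil _
  | cons h _ ih => exact .cons (Tr10.rep h) ih

theorem cons_mem_finTraces {s t : St10} {x : ActAC} {l : List ActAC} (h : Tr10 s x t)
    (hl : l ∈ A10.FinTraces t) : x :: l ∈ A10.FinTraces s :=
  let ⟨u, hu⟩ := hl
  ⟨u, .cons h hu⟩

theorem finTraces_p1_subset : A10.FinTraces .p1 ⊆ A10.FinTraces .p2 := by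
  rintro l ⟨t, ht⟩
  cases ht with
  | nil => exact ⟨_, .nil _⟩
  | cons h ht =>
    cases h
    exact ⟨t, .cons Tr10.pr2 ht⟩

theorem mem_finTraces_of_rep {l : List ActAC} :
    ∀ s : St10, l ∈ A10.FinTraces s.rep → l ∈ A10.FinTraces s := by
  induction l with
  | nil => exact fun s _ => ⟨s, .nil s⟩
  | cons x l ih =>
    rintro s ⟨u, hu⟩
    cases hu with
    | @cons _ t _ _ _ h ht =>
      have hl : l ∈ A10.FinTraces t := ⟨u, ht⟩
      cases s <;> cases h
      case p.pl1 => exact cons_mem_finTraces .pl1 hl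
      case p.pr1 => exact cons_mem_finTraces .pr1 hl
      case p1.pl2 => exact cons_mem_finTraces .pl2 hl
      case p2.pr2 => exact cons_mem_finTraces .pr2 hl
      case p2.pc => exact cons_mem_finTraces .pc hl
      case q.pl1 => exact cons_mem_finTraces .ql1 (ih .q1 hl)
      case q.pr1 => exact cons_mem_finTraces .qr1 (ih .q5 hl)
      case q1.pl2 => exact cons_mem_finTraces .ql2 (ih .q2 hl)
      case q2.pl1 => exact cons_mem_finTraces .ql3 (ih .q3 (finTraces_p1_subset hl))
      case q2.pr1 => exact cons_mem_finTraces .ql3 (ih .q3 hl)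
      case q3.pr2 => exact cons_mem_finTraces .ql4 (ih .q hl)
      case q3.pc => exact cons_mem_finTraces .qc1 (ih .q4 hl)
      case q5.pr2 => exact cons_mem_finTraces .qr2 (ih .q hl)
      case q5.pc => exact cons_mem_finTraces .qc2 (ih .q6 hl)

theorem finTraces_rep (s : St10) : A10.FinTraces s.rep = A10.FinTraces s :=
  Set.Subset.antisymm (fun _ => mem_finTraces_of_rep s) fun _ ⟨t, ht⟩ => ⟨t.rep, finRun_rep ht⟩

/-- Every run of `p` is matched by a run of `q`: leave `q` through `q1` only in the last step. -/
theorem exists_finRun_q : ∀ (l : List ActAC) {s : St10}, A10.FinRun .p l s →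
    ∃ t, A10.FinRun .q l t ∧ t.rep = s.rep
  | [], _, h => by
    cases h
    exact ⟨_, .nil _, rfl⟩
  | [_], _, h => by
    obtain _ | ⟨h, h'⟩ := h
    cases h'
    cases h
    · exact ⟨_, .cons Tr10.ql1 (.nil _), rfl⟩
    · exact ⟨_, .cons Tr10.qr1 (.nil _), rfl⟩
  | _ :: _ :: l, _, h => by
    obtain _ | ⟨h₁, _ | ⟨h₂, h⟩⟩ := h
    cases h₁ <;> cases h₂
    case pr1.pc =>
      obtain _ | ⟨h', _⟩ := h
      · exact ⟨_, .cons Tr10.qr1 (.cons Tr10.qc2 (.nil _)), rfl⟩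
      · cases h'
    all_goals
      obtain ⟨t, ht, e⟩ := exists_finRun_q l h
      exact ⟨t, .cons Tr10.qr1 (.cons Tr10.qr2 ht), e⟩

theorem possibleFutures_p_eq_q : A10.PossibleFutures .p = A10.PossibleFutures .q := by
  ext ⟨l, X⟩
  constructor
  · rintro ⟨s, hs, hX⟩
    obtain ⟨t, ht, e⟩ := exists_finRun_q l hs
    exact ⟨t, ht, by rw [hX, ← finTraces_rep s, ← e, finTraces_rep]⟩
  · rintro ⟨s, hs, hX⟩
    exact ⟨s.rep, finRun_rep hs, by rw [hX, finTraces_rep]⟩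

theorem infRun_label {s₀ : St10} {s : ℕ → St10} {w : ℕ → ActAC} (h : A10.InfRun s₀ s w) :
    w = fun _ => .a := by
  funext i
  have h₁ : Tr10 (s i) (w i) (s (i + 1)) := h.2 i
  have h₂ : Tr10 (s (i + 1)) (w (i + 1)) (s (i + 2)) := h.2 (i + 1)
  revert h₁ h₂
  generalize s i = x, w i = y, s (i + 1) = z, w (i + 1) = v, s (i + 2) = u
  intro h₁ h₂
  cases h₁ <;> first | rfl | cases h₂

theorem infRun_of_two_cycle {s t : St10} (h : Tr10 s .a t) (h' : Tr10 t .a s) :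
    A10.InfRun s (fun i => if Even i then s else t) fun _ => .a := by
  refine ⟨by simp, fun i => ?_⟩
  by_cases hi : Even i
  · simpa [hi, Nat.even_add_one, A10] using h
  · simpa [hi, Nat.even_add_one, A10] using h'

theorem infTraces_eq_of_two_cycle {s t : St10} (h : Tr10 s .a t) (h' : Tr10 t .a s) :
    A10.InfTraces s = {fun _ => .a} := by
  ext w
  constructor
  · rintro ⟨r, hr⟩
    exact infRun_label hr
  · rintro rfl
    exact ⟨_, infRun_of_two_cycle h h'⟩

theorem omega_mem_sFairLang_p : Sum.inr (fun _ => ActAC.a) ∈ A10.SFairLang {.c} .p := by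
  refine ⟨_, infRun_of_two_cycle .pl1 .pl2, ?_⟩
  rintro x rfl hen
  obtain ⟨j, -, t, ht⟩ := hen 0
  dsimp only at ht
  split_ifs at ht <;> cases ht

/-- The states reachable from `q` along `a`-transitions. -/
def QState (s : St10) : Prop := s = .q ∨ s = .q1 ∨ s = .q2 ∨ s = .q3 ∨ s = .q5

theorem QState.step {s t : St10} (hs : QState s) (h : Tr10 s .a t) : QState t := by
  cases h <;> simp_all [QState]

/-- Among any four consecutive states on an `a`-run from `q`, one enables `c`. -/
theorem QState.exists_enabled {s₀ s₁ s₂ s₃ : St10} (hs : QState s₀) (h₀ : Tr10 s₀ .a s₁)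
    (h₁ : Tr10 s₁ .a s₂) (h₂ : Tr10 s₂ .a s₃) :
    A10.Enabled s₀ .c ∨ A10.Enabled s₁ .c ∨ A10.Enabled s₂ .c ∨ A10.Enabled s₃ .c := by
  have h3 : A10.Enabled .q3 .c := ⟨_, Tr10.qc1⟩
  have h5 : A10.Enabled .q5 .c := ⟨_, Tr10.qc2⟩
  rcases hs with rfl | rfl | rfl | rfl | rfl <;> cases h₀ <;> cases h₁ <;> cases h₂ <;>
    simp [h3, h5]

theorem omega_notMem_sFairLang_q : Sum.inr (fun _ => ActAC.a) ∉ A10.SFairLang {.c} .q := by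
  rintro ⟨s, ⟨hs₀, hs⟩, hfair⟩
  have hq : ∀ i, QState (s i) := by
    intro i
    induction i with
    | zero => exact Or.inl hs₀
    | succ i ih => exact ih.step (hs i)
  obtain ⟨_, -, h⟩ := hfair .c rfl (fun i => by
    rcases (hq i).exists_enabled (hs i) (hs (i + 1)) (hs (i + 2)) with h | h | h | h
    exacts [⟨i, le_rfl, h⟩, ⟨i + 1, by omega, h⟩, ⟨i + 2, by omega, h⟩, ⟨i + 3, by omega, h⟩]) 0
  cases h

end A10

/-- The processes `p` and `q` of the LTS `A10` are infinitary
possible futures equivalent, yet `a^ω` is in the strong fair language of `p` w.r.t.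
`F = {c}` but not in that of `q`; in particular the strong fair languages differ. -/
theorem possible_futures_equiv_not_preserve_strong_fairness :
    A10.PossibleFutures St10.p = A10.PossibleFutures St10.q ∧
    A10.FinTraces St10.p = A10.FinTraces St10.q ∧
    A10.InfTraces St10.p = A10.InfTraces St10.q ∧
    Sum.inr (fun _ => ActAC.a) ∈ A10.SFairLang {ActAC.c} St10.p ∧
    Sum.inr (fun _ => ActAC.a) ∉ A10.SFairLang {ActAC.c} St10.q ∧
    A10.SFairLang {ActAC.c} St10.p ≠ A10.SFairLang {ActAC.c} St10.q := by
  refine ⟨A10.possibleFutures_p_eq_q, A10.finTraces_rep .q, ?_, A10.omega_mem_sFairLang_p,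
    A10.omega_notMem_sFairLang_q, fun h => A10.omega_notMem_sFairLang_q ?_⟩
  · rw [A10.infTraces_eq_of_two_cycle .pl1 .pl2, A10.infTraces_eq_of_two_cycle .qr1 .qr2]
  · exact h ▸ A10.omega_mem_sFairLang_p
end

section
/- There exists a finite labeled transition system A = (Q, Σ, →) with two processes p, q ∈ Q that are infinitary ready equivalent but whose weak fair languages differ for some F ⊆ Σ; concretely, over Σ = {a, b, c, d, e} take p branching by an a-step into a left bc-cycle of length two whose both states have outgoing d-transitions (to fresh sink states) and by an a-step into a right bc-cycle of length two whose both states have outgoing e-transitions, and take q branching by an a-step into a left bc-cycle whose first state has an outgoing d-transition and whose second state has an outgoing e-transition, and by an a-step into a right bc-cycle whose first state has an outgoing e-transition and whose second state has an outgoing d-transition. Then p and q are infinitary ready equivalent, yet for F = {d, e}, the infinite trace a(bc)^ω belongs to L^φ_{{d,e}}(q) but not to L^φ_{{d,e}}(p), so L^φ_{{d,e}}(p) ≠ L^φ_{{d,e}}(q). -/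
/-- The five-letter alphabet `{a, b, c, d, e}`. -/
inductive Act5 : Type
  | a | b | c | d | e

/-- States of the counterexample LTS for ready equivalence and weak fairness. -/
inductive St11 : Type
  | p | pl1 | pl2 | pd1 | pd2 | pr1 | pr2 | pe1 | pe2
  | q | ql1 | ql2 | qd1 | qe1 | qr1 | qr2 | qe2 | qd2

/-- Transitions: `p` branches by `a` into a left `bc`-cycle (`pl1 → pl2 → pl1`)
both of whose states have `d`-transitions to fresh sinks, and by `a` into a right
`bc`-cycle (`pr1 → pr2 → pr1`) both of whose states have `e`-transitions;
`q` branches by `a` into a left `bc`-cycle whose first state has a `d`-transition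
and whose second state has an `e`-transition, and by `a` into a right `bc`-cycle
whose first state has an `e`-transition and whose second state has a `d`-transition. -/
inductive Tr11 : St11 → Act5 → St11 → Prop
  | pal : Tr11 .p .a .pl1
  | plb : Tr11 .pl1 .b .pl2
  | plc : Tr11 .pl2 .c .pl1
  | pld1 : Tr11 .pl1 .d .pd1
  | pld2 : Tr11 .pl2 .d .pd2
  | par : Tr11 .p .a .pr1
  | prb : Tr11 .pr1 .b .pr2
  | prc : Tr11 .pr2 .c .pr1
  | pre1 : Tr11 .pr1 .e .pe1
  | pre2 : Tr11 .pr2 .e .pe2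
  | qal : Tr11 .q .a .ql1
  | qlb : Tr11 .ql1 .b .ql2
  | qlc : Tr11 .ql2 .c .ql1
  | qld : Tr11 .ql1 .d .qd1
  | qle : Tr11 .ql2 .e .qe1
  | qar : Tr11 .q .a .qr1
  | qrb : Tr11 .qr1 .b .qr2
  | qrc : Tr11 .qr2 .c .qr1
  | qre : Tr11 .qr1 .e .qe2
  | qrd : Tr11 .qr2 .d .qd2

/-- The counterexample LTS. -/
def A11 : LTS St11 Act5 := ⟨Tr11⟩

/-- The infinite trace `a (bc)^ω`. -/
def abcω11 : ℕ → Act5 := fun i =>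
  if i = 0 then Act5.a
  else if (i - 1) % 2 = 0 then Act5.b
  else Act5.c

namespace LTS

variable {Q σ : Type}

/-- A backward simulation: a step into a state is matched by a step into any related state. -/
def IsBackwardSimulation (A : LTS Q σ) (R : Q → Q → Prop) : Prop :=
  ∀ x a x' y', A.tr x a x' → R x' y' → ∃ y, R x y ∧ A.tr y a y'

theorem IsBackwardSimulation.finRun {A : LTS Q σ} {R : Q → Q → Prop}
    (hR : A.IsBackwardSimulation R) {x z : Q} {l : List σ} (h : A.FinRun x l z) :
    ∀ z', R z z' → ∃ y, R x y ∧ A.FinRun y l z' := by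
  induction h with
  | nil x => exact fun z' hz => ⟨z', hz, .nil z'⟩
  | cons hstep _ ih =>
    intro z' hz
    obtain ⟨y', hy', hrun⟩ := ih z' hz
    obtain ⟨y, hy, hs⟩ := hR _ _ _ _ hstep hy'
    exact ⟨y, hy, .cons hs hrun⟩

theorem IsBackwardSimulation.readyPairs_subset {A : LTS Q σ} {R : Q → Q → Prop}
    (hR : A.IsBackwardSimulation R)
    (hready : ∀ z, ∃ z', R z z' ∧ {a | A.Enabled z a} = {a | A.Enabled z' a})
    {p q : Q} (hpq : ∀ y, R p y → y = q) : A.ReadyPairs p ⊆ A.ReadyPairs q := by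
  rintro ⟨l, X⟩ ⟨z, hrun, hX⟩
  obtain ⟨z', hz, he⟩ := hready z
  obtain ⟨y, hy, hrun'⟩ := hR.finRun hrun z' hz
  obtain rfl := hpq y hy
  exact ⟨z', hrun', hX.trans he⟩

theorem finTraces_eq_image_readyPairs_s11 (A : LTS Q σ) (p : Q) :
    A.FinTraces p = Prod.fst '' A.ReadyPairs p := by
  ext l
  constructor
  · rintro ⟨z, h⟩
    exact ⟨(l, _), ⟨z, h, rfl⟩, rfl⟩
  · rintro ⟨_, ⟨z, h, -⟩, rfl⟩
    exact ⟨z, h⟩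

/-- A map preserving every step that can be continued preserves infinite runs. -/
theorem InfRun.map {A : LTS Q σ} {f : Q → Q}
    (hf : ∀ x a x' b x'', A.tr x a x' → A.tr x' b x'' → A.tr (f x) a (f x'))
    {p : Q} {s : ℕ → Q} {w : ℕ → σ} (h : A.InfRun p s w) : A.InfRun (f p) (f ∘ s) w :=
  ⟨congrArg f h.1, fun i => hf _ _ _ _ _ (h.2 i) (h.2 (i + 1))⟩

end LTS

namespace St11

/-- Whether a state belongs to the component of `p`. -/
def inP : St11 → Bool
  | p | pl1 | pl2 | pd1 | pd2 | pr1 | pr2 | pe1 | pe2 => true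
  | _ => false

/-- A code for the set of traces leading to a state from the root of its component. -/
def phase : St11 → ℕ
  | p | q => 0
  | pl1 | pr1 | ql1 | qr1 => 1
  | pl2 | pr2 | ql2 | qr2 => 2
  | pd1 | qd1 => 3
  | pd2 | qd2 => 4
  | pe1 | qe2 => 5
  | pe2 | qe1 => 6

/-- States of opposite components reached by the same traces. -/
def SameTraces (x y : St11) : Prop := phase x = phase y ∧ inP x = !inP y

/-- A state of the opposite component with the same phase and the same enabled actions. -/
def readyMate : St11 → St11
  | p => q | pl1 => ql1 | pl2 => qr2 | pr1 => qr1 | pr2 => ql2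
  | pd1 => qd1 | pd2 => qd2 | pe1 => qe2 | pe2 => qe1
  | q => p | ql1 => pl1 | ql2 => pr2 | qr1 => pr1 | qr2 => pl2
  | qd1 => pd1 | qd2 => pd2 | qe2 => pe1 | qe1 => pe2

/-- The exchange of the two components on states that are not sinks. -/
def swap : St11 → St11
  | p => q | pl1 => ql1 | pl2 => ql2 | pr1 => qr1 | pr2 => qr2
  | q => p | ql1 => pl1 | ql2 => pl2 | qr1 => pr1 | qr2 => pr2
  | x => x

theorem sameTraces_p {y : St11} (h : SameTraces p y) : y = q := by
  cases y <;> simp_all [SameTraces, phase, inP]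

theorem sameTraces_q {y : St11} (h : SameTraces q y) : y = p := by
  cases y <;> simp_all [SameTraces, phase, inP]

theorem sameTraces_readyMate (x : St11) : SameTraces x (readyMate x) := by
  cases x <;> exact ⟨rfl, rfl⟩

theorem isBackwardSimulation_sameTraces : A11.IsBackwardSimulation SameTraces := by
  rintro x α x' y' (h : Tr11 x α x') ⟨h₁, h₂⟩
  cases h <;> cases y' <;>
    first
    | exact absurd h₁ (by decide)
    | exact absurd h₂ (by decide)
    | exact ⟨_, And.symm ⟨by constructor, by exact ⟨rfl, rfl⟩⟩⟩

theorem enabled_readyMate (x : St11) :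
    {α | A11.Enabled x α} = {α | A11.Enabled (readyMate x) α} := by
  ext α
  constructor
  · rintro ⟨x', h : Tr11 x α x'⟩
    cases h <;> exact ⟨_, by constructor⟩
  · rintro ⟨x', h : Tr11 (readyMate x) α x'⟩
    cases x <;> cases h <;> exact ⟨_, by constructor⟩

theorem tr_swap (x : St11) (α : Act5) (x' : St11) (β : Act5) (x'' : St11)
    (h₁ : A11.tr x α x') (h₂ : A11.tr x' β x'') : A11.tr (swap x) α (swap x') := by
  change Tr11 x α x' at h₁
  change Tr11 x' β x'' at h₂
  change Tr11 (swap x) α (swap x')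
  cases h₁ <;> first | constructor | cases h₂

/-- The run of `q` through its left cycle. -/
def leftRun (i : ℕ) : St11 :=
  if i = 0 then q else if (i - 1) % 2 = 0 then ql1 else ql2

theorem infRun_leftRun : A11.InfRun q leftRun abcω11 := by
  refine ⟨rfl, fun i => ?_⟩
  rcases i with _ | i
  · exact Tr11.qal
  · rcases Nat.mod_two_eq_zero_or_one i with h | h
    · have h' : (i + 1) % 2 = 1 := by omega
      simpa [A11, leftRun, abcω11, h, h'] using Tr11.qlb
    · have h' : (i + 1) % 2 = 0 := by omega
      simpa [A11, leftRun, abcω11, h, h'] using Tr11.qlc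

theorem weakFair_leftRun : A11.WeakFair {Act5.d, Act5.e} leftRun abcω11 := by
  rintro _ (rfl | rfl) ⟨i, hi⟩
  · obtain ⟨x, h⟩ := hi (2 * i + 2) (by omega)
    have hs : leftRun (2 * i + 2) = ql2 := by
      simp [leftRun, Nat.add_mod]
    rw [hs] at h
    cases (h : Tr11 _ _ _)
  · obtain ⟨x, h⟩ := hi (2 * i + 1) (by omega)
    have hs : leftRun (2 * i + 1) = ql1 := by
      simp [leftRun]
    rw [hs] at h
    cases (h : Tr11 _ _ _)

theorem abcω11_ne_d (i : ℕ) : abcω11 i ≠ Act5.d := by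
  unfold abcω11
  split_ifs <;> simp

theorem abcω11_ne_e (i : ℕ) : abcω11 i ≠ Act5.e := by
  unfold abcω11
  split_ifs <;> simp

/-- Infinite runs of `p` stay in the left cycle or in the right one. -/
theorem infRun_p_cases {s : ℕ → St11} {w : ℕ → Act5} (h : A11.InfRun p s w) :
    (∀ i, s (i + 1) = pl1 ∨ s (i + 1) = pl2) ∨ (∀ i, s (i + 1) = pr1 ∨ s (i + 1) = pr2) := by
  have step : ∀ i, Tr11 (s i) (w i) (s (i + 1)) := h.2
  have h₀ := step 0
  rw [h.1] at h₀
  generalize w 0 = α, hs : s (0 + 1) = x at h₀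
  cases h₀
  · refine .inl fun i => ?_
    induction i with
    | zero => exact .inl hs
    | succ i ih =>
      have h₁ := step (i + 1)
      have h₂ := step (i + 1 + 1)
      generalize w (i + 1) = α, w (i + 1 + 1) = β, s (i + 1 + 1) = y at h₁ h₂ ⊢
      rcases ih with ih | ih <;> rw [ih] at h₁ <;> cases h₁ <;>
        first | exact .inl rfl | exact .inr rfl | cases h₂
  · refine .inr fun i => ?_
    induction i with
    | zero => exact .inl hs
    | succ i ih =>
      have h₁ := step (i + 1)
      have h₂ := step (i + 1 + 1)
      generalize w (i + 1) = α, w (i + 1 + 1) = β, s (i + 1 + 1) = y at h₁ h₂ ⊢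
      rcases ih with ih | ih <;> rw [ih] at h₁ <;> cases h₁ <;>
        first | exact .inl rfl | exact .inr rfl | cases h₂

theorem not_weakFair_of_infRun_p {s : ℕ → St11} (h : A11.InfRun p s abcω11) :
    ¬ A11.WeakFair {Act5.d, Act5.e} s abcω11 := by
  intro hfair
  rcases infRun_p_cases h with hl | hr
  · obtain ⟨j, -, hj⟩ := hfair Act5.d (by simp) ⟨1, fun j hj => by
      obtain ⟨k, rfl⟩ := Nat.exists_eq_add_of_le' hj
      rcases hl k with hk | hk <;> rw [hk]
      exacts [⟨_, Tr11.pld1⟩, ⟨_, Tr11.pld2⟩]⟩ 0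
    exact abcω11_ne_d j hj
  · obtain ⟨j, -, hj⟩ := hfair Act5.e (by simp) ⟨1, fun j hj => by
      obtain ⟨k, rfl⟩ := Nat.exists_eq_add_of_le' hj
      rcases hr k with hk | hk <;> rw [hk]
      exacts [⟨_, Tr11.pre1⟩, ⟨_, Tr11.pre2⟩]⟩ 0
    exact abcω11_ne_e j hj

theorem readyPairs_p_eq_readyPairs_q : A11.ReadyPairs p = A11.ReadyPairs q := by
  have hready (z : St11) :
      ∃ z', SameTraces z z' ∧ {α | A11.Enabled z α} = {α | A11.Enabled z' α} :=
    ⟨_, sameTraces_readyMate z, enabled_readyMate z⟩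
  exact Set.Subset.antisymm
    (isBackwardSimulation_sameTraces.readyPairs_subset hready fun _ => sameTraces_p)
    (isBackwardSimulation_sameTraces.readyPairs_subset hready fun _ => sameTraces_q)

theorem infTraces_p_eq_infTraces_q : A11.InfTraces p = A11.InfTraces q :=
  Set.Subset.antisymm (fun _ ⟨_, h⟩ => ⟨_, h.map tr_swap⟩) (fun _ ⟨_, h⟩ => ⟨_, h.map tr_swap⟩)

end St11

/-- The processes `p` and `q` of the LTS `A11` are infinitary ready
equivalent, yet `a(bc)^ω` is in the weak fair language of `q` w.r.t. `F = {d, e}` but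
not in that of `p`; in particular the weak fair languages differ. -/
theorem ready_equiv_not_preserve_weak_fairness :
    A11.ReadyPairs St11.p = A11.ReadyPairs St11.q ∧
    A11.FinTraces St11.p = A11.FinTraces St11.q ∧
    A11.InfTraces St11.p = A11.InfTraces St11.q ∧
    Sum.inr abcω11 ∈ A11.WFairLang {Act5.d, Act5.e} St11.q ∧
    Sum.inr abcω11 ∉ A11.WFairLang {Act5.d, Act5.e} St11.p ∧
    A11.WFairLang {Act5.d, Act5.e} St11.p ≠ A11.WFairLang {Act5.d, Act5.e} St11.q := by
  have hq : Sum.inr abcω11 ∈ A11.WFairLang {Act5.d, Act5.e} St11.q :=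
    ⟨_, St11.infRun_leftRun, St11.weakFair_leftRun⟩
  have hp : Sum.inr abcω11 ∉ A11.WFairLang {Act5.d, Act5.e} St11.p :=
    fun ⟨_, hrun, hfair⟩ => St11.not_weakFair_of_infRun_p hrun hfair
  refine ⟨St11.readyPairs_p_eq_readyPairs_q, ?_, St11.infTraces_p_eq_infTraces_q, hq, hp,
    fun h => hp (h ▸ hq)⟩
  rw [LTS.finTraces_eq_image_readyPairs_s11, LTS.finTraces_eq_image_readyPairs_s11,
    St11.readyPairs_p_eq_readyPairs_q]
end
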